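/- For every n ≥ 0: (i) for every spanning tree t ∈ T_n, the number of spanning trees t' ∈ T_{n+1} with Tr t' = t equals 18 · 540^{(3^n−1)/2}; (ii) for every i ∈ {1,2,3} and every f ∈ S_n^i, the number of f' ∈ S_{n+1}^i with Tr f' = f equals 30 · 540^{(3^n−1)/2}; (iii) for every f ∈ R_n, the number of f' ∈ R_{n+1} with Tr f' = f equals 50 · 540^{(3^n−1)/2}. Consequently, the pushforward under Tr of the uniform distribution on T_{n+1} (respectively S_{n+1}^i, R_{n+1}) is the uniform distribution on T_n (respectively S_n^i, R_n). -/

import Mathlib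

attribute [local instance] Classical.propDecidable

noncomputable section

/-- Points in the plane. -/
abbrev Pt : Type := ℝ × ℝ

/-- The three corner vertices `u₁ = (0,0)`, `u₂ = (1,0)`, `u₃ = (1/2, √3/2)`. -/
def cornerPt : Fin 3 → Pt
  | 0 => (0, 0)
  | 1 => (1, 0)
  | 2 => (1 / 2, Real.sqrt 3 / 2)

/-- The similitude `ψ_i(x) = (x + u_i)/2`. -/
def psi (i : Fin 3) (x : Pt) : Pt := ((x.1 + (cornerPt i).1) / 2, (x.2 + (cornerPt i).2) / 2)

/-- Vertex set of the Sierpiński graph `G_n`. -/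
def sierpV : ℕ → Finset Pt
  | 0 => {cornerPt 0, cornerPt 1, cornerPt 2}
  | n + 1 => (sierpV n).image (psi 0) ∪ (sierpV n).image (psi 1) ∪ (sierpV n).image (psi 2)

/-- Edge set of the Sierpiński graph `G_n`. -/
def sierpE : ℕ → Finset (Sym2 Pt)
  | 0 => {s(cornerPt 0, cornerPt 1), s(cornerPt 1, cornerPt 2), s(cornerPt 2, cornerPt 0)}
  | n + 1 =>
      (sierpE n).image (Sym2.map (psi 0)) ∪ (sierpE n).image (Sym2.map (psi 1)) ∪
        (sierpE n).image (Sym2.map (psi 2))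

/-- The simple graph spanned by a finite set of edges. -/
def graphOf (F : Finset (Sym2 Pt)) : SimpleGraph Pt := SimpleGraph.fromEdgeSet ↑F

/-- Spanning trees of `G_n`: acyclic edge subsets connecting all vertices of `G_n`. -/
def treeSet (n : ℕ) : Finset (Finset (Sym2 Pt)) :=
  (sierpE n).powerset.filter fun F =>
    (graphOf F).IsAcyclic ∧ ∀ x ∈ sierpV n, ∀ y ∈ sierpV n, (graphOf F).Reachable x y

/-- `S_n^i` (with `i : Fin 3` zero-based): spanning forests of `G_n` with exactly two
components, one containing corner `i`, the other containing the two remaining corners. -/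
def twoForestSet (n : ℕ) (i : Fin 3) : Finset (Finset (Sym2 Pt)) :=
  (sierpE n).powerset.filter fun F =>
    (graphOf F).IsAcyclic ∧
    (∀ j, j ≠ i → ¬ (graphOf F).Reachable (cornerPt i) (cornerPt j)) ∧
    (∀ j k, j ≠ i → k ≠ i → (graphOf F).Reachable (cornerPt j) (cornerPt k)) ∧
    (∀ x ∈ sierpV n, ∃ j, (graphOf F).Reachable (cornerPt j) x)

/-- `R_n`: spanning forests of `G_n` with exactly three components, each containing
exactly one corner vertex. -/
def threeForestSet (n : ℕ) : Finset (Finset (Sym2 Pt)) :=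
  (sierpE n).powerset.filter fun F =>
    (graphOf F).IsAcyclic ∧
    (∀ j k, j ≠ k → ¬ (graphOf F).Reachable (cornerPt j) (cornerPt k)) ∧
    (∀ x ∈ sierpV n, ∃ j, (graphOf F).Reachable (cornerPt j) x)

/-- Edges of the copy `ψ_i(G_n)` inside `G_{n+1}`. -/
def psiCellE (i : Fin 3) (n : ℕ) : Finset (Sym2 Pt) := (sierpE n).image (Sym2.map (psi i))

/-- The class `T_n^i`: for `n ≥ 1`, spanning trees whose unique path from corner `i`
to any other corner `j` stays in `ψ_i(G_{n-1}) ∪ ψ_j(G_{n-1})`; for `n = 0` the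
singleton consisting of the two edges of `G_0` incident with corner `i`. -/
def treeClass : ℕ → Fin 3 → Finset (Finset (Sym2 Pt))
  | 0, i => {(sierpE 0).filter fun e => cornerPt i ∈ e}
  | n + 1, i =>
      (treeSet (n + 1)).filter fun F =>
        ∀ j, j ≠ i → ∀ p : (graphOf F).Walk (cornerPt i) (cornerPt j), p.IsPath →
          ∀ e ∈ p.edges, e ∈ psiCellE i n ∪ psiCellE j n

/-- `ψ_w = ψ_{w₁} ∘ ⋯ ∘ ψ_{w_k}` for a word `w` of length `k`. -/
def psiWord {k : ℕ} (w : Fin k → Fin 3) : Pt → Pt :=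
  (List.ofFn w).foldr (fun i g => psi i ∘ g) id

/-- The restriction `π_w(F) = ψ_w^{-1}(F ∩ ψ_w(G_{m-k}))` of an edge set `F ⊆ E G_m`
to the `k`-part indexed by the word `w`, as a subgraph of `G_{m-k}`. -/
def restrictE {k : ℕ} (w : Fin k → Fin 3) (m : ℕ) (F : Finset (Sym2 Pt)) :
    Finset (Sym2 Pt) :=
  (sierpE (m - k)).filter fun e => Sym2.map (psiWord w) e ∈ F

/-- Number of connected components of the subgraph with edge set `F`,
on the vertex set of `G_m`. -/
def ncomp (m : ℕ) (F : Finset (Sym2 Pt)) : ℕ :=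
  Set.ncard {C : Set Pt | ∃ v ∈ sierpV m, C = {x : Pt | x ∈ sierpV m ∧ (graphOf F).Reachable v x}}

/-- Degree of `v` in the edge set `F`. -/
def degIn (F : Finset (Sym2 Pt)) (v : Pt) : ℕ := (F.filter fun e => v ∈ e).card

/-- The subgraph of `G_0` replacing a forest in `Q_1`, used in the trace construction. -/
def traceCell (g : Finset (Sym2 Pt)) : Finset (Sym2 Pt) :=
  if g ∈ treeClass 1 0 then (sierpE 0).filter (fun e => cornerPt 0 ∈ e)
  else if g ∈ treeClass 1 1 then (sierpE 0).filter (fun e => cornerPt 1 ∈ e)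
  else if g ∈ treeClass 1 2 then (sierpE 0).filter (fun e => cornerPt 2 ∈ e)
  else if g ∈ twoForestSet 1 0 then (sierpE 0).filter (fun e => cornerPt 0 ∉ e)
  else if g ∈ twoForestSet 1 1 then (sierpE 0).filter (fun e => cornerPt 1 ∉ e)
  else if g ∈ twoForestSet 1 2 then (sierpE 0).filter (fun e => cornerPt 2 ∉ e)
  else ∅

/-- The trace `Tr f ⊆ E G_n` of an edge set `f ⊆ E G_{n+1}`. -/
def trace (n : ℕ) (f : Finset (Sym2 Pt)) : Finset (Sym2 Pt) :=
  Finset.univ.biUnion fun w : Fin n → Fin 3 =>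
    (traceCell (restrictE w (n + 1) f)).image (Sym2.map (psiWord w))

/-- `Q_n = T_n ∪ S_n^1 ∪ S_n^2 ∪ S_n^3 ∪ R_n`. -/
def qSet (n : ℕ) : Finset (Finset (Sym2 Pt)) :=
  treeSet n ∪ twoForestSet n 0 ∪ twoForestSet n 1 ∪ twoForestSet n 2 ∪ threeForestSet n

section Combinatorics

attribute [local instance] instDecidableEqFin instDecidableEqBool instDecidableEqNat

/-- The partitions of the set of three corners: one block, the corner `i` split off from the
other two, or three singletons. -/
inductive CornerPartition
  | one
  | two (i : Fin 3)
  | three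
  deriving DecidableEq, Fintype

namespace CornerPartition

attribute [local instance] instDecidableEqCornerPartition

/-- `j` and `k` lie in the same block. -/
def rel : CornerPartition → Fin 3 → Fin 3 → Bool
  | one, _, _ => true
  | two i, j, k => decide (j = k) || (!decide (j = i) && !decide (k = i))
  | three, j, k => decide (j = k)

/-- The partition whose blocks are the classes of an equivalence relation. -/
def ofRel (r : Fin 3 → Fin 3 → Bool) : CornerPartition :=
  bif r 0 1 then (bif r 1 2 then one else two 2)
  else bif r 1 2 then two 0 else bif r 0 2 then two 1 else three

/-- Universal quantification over all partitions, as a Boolean. -/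
def all (f : CornerPartition → Bool) : Bool :=
  f one && f (two 0) && f (two 1) && f (two 2) && f three

/-- Universal quantification over `Fin 3`, as a Boolean. -/
def allFin (f : Fin 3 → Bool) : Bool := f 0 && f 1 && f 2

theorem all_iff (f : CornerPartition → Bool) : all f = true ↔ ∀ q, f q = true := by
  constructor
  · intro h q
    simp only [all, Bool.and_eq_true] at h
    cases q with
    | one => exact h.1.1.1.1
    | two i => fin_cases i; exacts [h.1.1.1.2, h.1.1.2, h.1.2]
    | three => exact h.2
  · intro h
    simp [all, h]

theorem allFin_iff (f : Fin 3 → Bool) : allFin f = true ↔ ∀ i, f i = true := by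
  simp [allFin, Fin.forall_fin_succ, and_assoc]

/-- The triple `(a, b, c)` as a function. -/
def triple {α : Type*} (a b c : α) : Fin 3 → α
  | 0 => a
  | 1 => b
  | 2 => c

theorem triple_eta {α : Type*} (q : Fin 3 → α) : triple (q 0) (q 1) (q 2) = q := by
  funext i; fin_cases i <;> rfl

/-- Universal quantification over all triples of partitions, as a Boolean. -/
def allTriple (f : (Fin 3 → CornerPartition) → Bool) : Bool :=
  all fun a => all fun b => all fun c => f (triple a b c)

theorem allTriple_iff (f : (Fin 3 → CornerPartition) → Bool) :
    allTriple f = true ↔ ∀ q, f q = true := by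
  simp only [allTriple, all_iff]
  refine ⟨fun h q => ?_, fun h a b c => h _⟩
  simpa only [triple_eta] using h (q 0) (q 1) (q 2)

/-- The joints of the cell `i` are connected through the other two cells. -/
def thru (q : Fin 3 → CornerPartition) (i : Fin 3) : Bool :=
  rel (q (i + 1)) i (i + 2) && rel (q (i + 2)) (i + 1) i

/-- Corner `j` of cell `i` is connected to corner `l` of cell `k` when three cells with
corner partitions `q` are glued at their joints. -/
def conn (q : Fin 3 → CornerPartition) (i j k l : Fin 3) : Bool :=
  bif decide (i = k) then
    rel (q i) j l || (thru q i &&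
      ((rel (q i) j (i + 1) && rel (q i) (i + 2) l) ||
        (rel (q i) j (i + 2) && rel (q i) (i + 1) l)))
  else (rel (q i) j k && rel (q k) i l) ||
    (rel (q i) j (-(i + k)) && rel (q (-(i + k))) i k && rel (q k) (-(i + k)) l)

/-- Gluing creates no cycle, and every corner of a cell is connected to an outer corner. -/
def good (q : Fin 3 → CornerPartition) : Bool :=
  !(thru q 0 && rel (q 0) 1 2) &&
    allFin fun i => allFin fun j => conn q i j 0 0 || conn q i j 1 1 || conn q i j 2 2

/-- The partition of the outer corners after gluing. -/
def glued (q : Fin 3 → CornerPartition) : CornerPartition :=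
  ofRel fun j k => conn q j j k k

/-- The paths from the outer corner `i` to the other two use only direct connections. -/
def central (q : Fin 3 → CornerPartition) (i : Fin 3) : Bool :=
  allFin fun j => decide (j = i) || (rel (q i) i j && rel (q j) i j)

/-- The centre of a glued tree. -/
def centre (q : Fin 3 → CornerPartition) : Fin 3 :=
  bif central q 0 then 0 else bif central q 1 then 1 else 2

/-- The fibre size at the lowest level. -/
def weight : CornerPartition → ℕ
  | one => 18
  | two _ => 30
  | three => 50

/-- The number of forests of a triangle with a given corner partition. -/
def triangleCount : CornerPartition → ℕ
  | one => 3
  | two _ => 1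
  | three => 1

theorem rel_refl (q : CornerPartition) (j : Fin 3) : rel q j j = true := by
  cases q <;> simp [rel]

theorem rel_symm {q : CornerPartition} {j k : Fin 3} (h : rel q j k = true) :
    rel q k j = true := by
  cases q <;> simp_all [rel]; tauto

theorem rel_ofRel (r : Fin 3 → Fin 3 → Bool) (h₀ : ∀ i, r i i = true)
    (hs : ∀ i j, r i j = true → r j i = true)
    (ht : ∀ i j k, r i j = true → r j k = true → r i k = true) (j k : Fin 3) :
    rel (ofRel r) j k = r j k := by
  have hs' : ∀ i j, r i j = r j i := fun i j => Bool.eq_iff_iff.2 ⟨hs i j, hs j i⟩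
  have e1 := hs' 1 0
  have e2 := hs' 2 1
  have e3 := hs' 2 0
  have t1 := ht 0 1 2
  have t2 := ht 0 2 1
  have t3 := ht 1 0 2
  clear hs hs' ht
  unfold ofRel
  rcases h1 : r 0 1 <;> rcases h2 : r 1 2 <;> rcases h3 : r 0 2 <;>
    fin_cases j <;> fin_cases k <;> simp_all [rel]

theorem ofRel_rel (q : CornerPartition) : ofRel (rel q) = q := by
  cases q with
  | one => rfl
  | two i => fin_cases i <;> rfl
  | three => rfl

theorem eq_of_rel {q r : CornerPartition} (h : ∀ j k, rel q j k = rel r j k) : q = r := by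
  rw [← ofRel_rel q, ← ofRel_rel r, show rel q = rel r from funext₂ h]

theorem conn_of_rel {q : Fin 3 → CornerPartition} {i j l : Fin 3} (h : rel (q i) j l = true) :
    conn q i j i l = true := by
  simp [conn, h]

theorem conn_rel_check : (allTriple fun q => allFin fun i => allFin fun j => allFin fun k =>
    allFin fun l => !conn q i j k l || (conn q i j l k &&
      allFin fun m => !rel (q k) l m || conn q i j k m)) = true := by
  decide +kernel

theorem conn_step {q : Fin 3 → CornerPartition} {i j k l m : Fin 3} (h : conn q i j k l = true)
    (h' : rel (q k) l m = true) : conn q i j k m = true := by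
  have := (allTriple_iff _).1 conn_rel_check q
  simp only [allFin_iff] at this
  have := this i j k l
  simp only [h, Bool.not_true, Bool.false_or, Bool.and_eq_true, allFin_iff] at this
  simpa [h'] using this.2 m

theorem conn_swap {q : Fin 3 → CornerPartition} {i j k l : Fin 3} (h : conn q i j k l = true) :
    conn q i j l k = true := by
  have := (allTriple_iff _).1 conn_rel_check q
  simp only [allFin_iff] at this
  have := this i j k l
  simp only [h, Bool.not_true, Bool.false_or, Bool.and_eq_true] at this
  exact this.1

theorem conn_symm {q : Fin 3 → CornerPartition} {i j k l : Fin 3} (h : conn q i j k l = true) :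
    conn q k l i j = true := by
  have : (allTriple fun q => allFin fun i => allFin fun j => allFin fun k => allFin fun l =>
      !conn q i j k l || conn q k l i j) = true := by
    decide +kernel
  simp only [allTriple_iff, allFin_iff] at this
  simpa [h] using this q i j k l

theorem thru_rotate (q : Fin 3 → CornerPartition) (i : Fin 3) :
    (thru q i && rel (q i) (i + 1) (i + 2)) = (thru q 0 && rel (q 0) 1 2) := by
  have : (allTriple fun q => allFin fun i =>
      decide ((thru q i && rel (q i) (i + 1) (i + 2)) = (thru q 0 && rel (q 0) 1 2))) = true := by
    decide +kernel
  simp only [allTriple_iff, allFin_iff, decide_eq_true_eq] at this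
  exact this q i

theorem weight_glued {q : Fin 3 → CornerPartition} (h : good q = true) :
    ∏ i, weight (q i) = 540 * weight (glued q) := by
  have : (allTriple fun q => !good q ||
      decide (weight (q 0) * weight (q 1) * weight (q 2) = 540 * weight (glued q))) = true := by
    decide +kernel
  simp only [allTriple_iff] at this
  simpa [h, Fin.prod_univ_three] using this q

theorem central_centre {q : Fin 3 → CornerPartition} (h : good q = true)
    (h' : glued q = one) : central q (centre q) = true := by
  have : (allTriple fun q => !good q || !decide (glued q = one) || central q (centre q)) = true := by
    decide +kernel
  simp only [allTriple_iff] at this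
  simpa [h, h'] using this q

/-- Connectivity of the corners of a triangle in which the edge opposite to corner `i` is
present iff `b i`. -/
def triangleRel (b : Fin 3 → Bool) (j k : Fin 3) : Bool :=
  decide (j = k) || b (-(j + k)) || (b j && b k)

/-- The indicator of the edges of the trace of a glued forest. -/
def traceEdges (q : Fin 3 → CornerPartition) (i : Fin 3) : Bool :=
  match glued q with
  | one => !decide (i = centre q)
  | two j => decide (i = j)
  | three => false

theorem triangle_traceEdges {q : Fin 3 → CornerPartition} (h : good q = true) :
    allFin (traceEdges q) = false ∧ ofRel (triangleRel (traceEdges q)) = glued q := by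
  have : (allTriple fun q => !good q || (!allFin (traceEdges q) &&
      decide (ofRel (triangleRel (traceEdges q)) = glued q))) = true := by
    decide +kernel
  simp only [allTriple_iff] at this
  simpa [h] using this q

/-- The edge indicators of the forests of a triangle with a given corner partition. -/
def triangleForests (r : CornerPartition) : Finset (Fin 3 → Bool) :=
  Finset.univ.filter fun b => (!allFin b && decide (ofRel (triangleRel b) = r)) = true

theorem card_triangleForests (r : CornerPartition) :
    (triangleForests r).card = triangleCount r := by
  have : ∀ r, decide ((triangleForests r).card = triangleCount r) = true :=
    (all_iff _).1 (by decide +kernel)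
  simpa using this r

theorem sum_eq_all (f : CornerPartition → ℕ) :
    ∑ q, f q = f one + f (two 0) + f (two 1) + f (two 2) + f three := by
  rw [show (Finset.univ : Finset CornerPartition) = {one, two 0, two 1, two 2, three} by decide]
  simp [Finset.sum_insert, add_assoc]

/-- The equivalence between functions on `Fin 3` and triples. -/
def tripleEquiv (α : Type*) : α × α × α ≃ (Fin 3 → α) where
  toFun p := triple p.1 p.2.1 p.2.2
  invFun q := (q 0, q 1, q 2)
  left_inv _ := rfl
  right_inv q := triple_eta q

theorem sum_triple (f : (Fin 3 → CornerPartition) → ℕ) :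
    ∑ q, f q = ∑ a, ∑ b, ∑ c, f (triple a b c) := by
  rw [← (tripleEquiv CornerPartition).sum_comp, Fintype.sum_prod_type]
  simp only [Fintype.sum_prod_type]
  rfl

theorem sum_traceEdges {b : Fin 3 → Bool} (h : allFin b = false) :
    ∑ q, (bif good q && allFin (fun i => decide (traceEdges q i = b i)) then
      ∏ i, triangleCount (q i) else 0) = weight (ofRel (triangleRel b)) := by
  simp only [sum_triple, sum_eq_all, Fin.prod_univ_three]
  rw [← triple_eta b] at h ⊢
  generalize b 0 = x at *
  generalize b 1 = y at *
  generalize b 2 = z at *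
  revert x y z
  decide +kernel

end CornerPartition
end Combinatorics

section Geometry

/-- Barycentric coordinates with respect to the three corners. -/
def bary (i : Fin 3) (x : Pt) : ℝ :=
  match i with
  | 0 => 1 - x.1 - x.2 / Real.sqrt 3
  | 1 => x.1 - x.2 / Real.sqrt 3
  | 2 => 2 * (x.2 / Real.sqrt 3)

theorem bary_cornerPt (i j : Fin 3) : bary i (cornerPt j) = if i = j then 1 else 0 := by
  have h : Real.sqrt 3 / 2 / Real.sqrt 3 = 1 / 2 := by
    have : Real.sqrt 3 ≠ 0 := by positivity
    field_simp
  fin_cases i <;> fin_cases j <;> simp [bary, cornerPt, h]; norm_num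

theorem bary_sum (x : Pt) : bary 0 x + bary 1 x + bary 2 x = 1 := by
  simp only [bary]; ring

theorem bary_psi (i j : Fin 3) (x : Pt) :
    bary j (psi i x) = (bary j x + bary j (cornerPt i)) / 2 := by
  fin_cases j <;> simp only [bary, psi] <;> ring

theorem bary_injective {x y : Pt} (h : ∀ i, bary i x = bary i y) : x = y := by
  have h1 := h 1
  have h2 := h 2
  simp only [bary] at h1 h2
  have h3 : Real.sqrt 3 ≠ 0 := by positivity
  have h4 : x.2 / Real.sqrt 3 = y.2 / Real.sqrt 3 := by linarith
  refine Prod.ext (by linarith) ?_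
  field_simp at h4
  exact h4

theorem cornerPt_injective : Function.Injective cornerPt := by
  intro i j h
  have := bary_cornerPt i j
  rw [← h, bary_cornerPt] at this
  by_contra hij
  simp [hij] at this

theorem psi_injective (i : Fin 3) : Function.Injective (psi i) := by
  intro x y h
  refine bary_injective fun j => ?_
  have := congrArg (bary j) h
  simp only [bary_psi] at this
  linarith

theorem mem_sierpV_succ {n : ℕ} {x : Pt} :
    x ∈ sierpV (n + 1) ↔ ∃ i, ∃ a ∈ sierpV n, psi i a = x := by
  simp [sierpV, Fin.exists_fin_succ]

theorem mem_sierpE_succ {n : ℕ} {e : Sym2 Pt} :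
    e ∈ sierpE (n + 1) ↔ ∃ i, ∃ e' ∈ sierpE n, Sym2.map (psi i) e' = e := by
  simp [sierpE, Fin.exists_fin_succ]

theorem psi_cornerPt_self (i : Fin 3) : psi i (cornerPt i) = cornerPt i := by
  simp [psi]

theorem psi_cornerPt_comm (i j : Fin 3) : psi i (cornerPt j) = psi j (cornerPt i) := by
  simp [psi, add_comm]

theorem cornerPt_mem (n : ℕ) (i : Fin 3) : cornerPt i ∈ sierpV n := by
  induction n with
  | zero => fin_cases i <;> simp [sierpV]
  | succ n ih => exact mem_sierpV_succ.2 ⟨i, _, ih, psi_cornerPt_self i⟩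

theorem mem_sierpV_zero {x : Pt} : x ∈ sierpV 0 ↔ ∃ i, cornerPt i = x := by
  simp [sierpV, Fin.exists_fin_succ, eq_comm]

theorem bary_nonneg {n : ℕ} {x : Pt} (hx : x ∈ sierpV n) (i : Fin 3) : 0 ≤ bary i x := by
  induction n generalizing x with
  | zero =>
    obtain ⟨j, rfl⟩ := mem_sierpV_zero.1 hx
    rw [bary_cornerPt]
    split_ifs <;> norm_num
  | succ n ih =>
    obtain ⟨j, a, ha, rfl⟩ := mem_sierpV_succ.1 hx
    have := ih ha
    rw [bary_psi, bary_cornerPt]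
    split_ifs <;> linarith

theorem eq_cornerPt_of_bary {n : ℕ} {x : Pt} (hx : x ∈ sierpV n) {j : Fin 3}
    (h : 1 ≤ bary j x) : x = cornerPt j := by
  have h0 := bary_nonneg hx 0
  have h1 := bary_nonneg hx 1
  have h2 := bary_nonneg hx 2
  have hs := bary_sum x
  refine bary_injective fun i => ?_
  rw [bary_cornerPt]
  fin_cases j <;> fin_cases i <;> simp at h ⊢ <;> linarith

theorem psi_eq_psi {n : ℕ} {x y : Pt} (hx : x ∈ sierpV n) (hy : y ∈ sierpV n) {i j : Fin 3}
    (hij : i ≠ j) (h : psi i x = psi j y) : x = cornerPt j ∧ y = cornerPt i := by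
  have hj := congrArg (bary j) h
  have hi := congrArg (bary i) h
  simp only [bary_psi, bary_cornerPt, if_neg hij, if_neg hij.symm, if_true] at hi hj
  have := bary_nonneg hx i
  have := bary_nonneg hy j
  exact ⟨eq_cornerPt_of_bary hx (by linarith), eq_cornerPt_of_bary hy (by linarith)⟩

theorem sierpE_zero : sierpE 0 =
    Finset.univ.image fun i : Fin 3 => s(cornerPt (i + 1), cornerPt (i + 2)) := by
  ext e
  simp [sierpE, Fin.exists_fin_succ, eq_comm]
  tauto

theorem mem_of_mem_sierpE {n : ℕ} {x y : Pt} (h : s(x, y) ∈ sierpE n) :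
    x ∈ sierpV n ∧ y ∈ sierpV n ∧ x ≠ y := by
  induction n generalizing x y with
  | zero =>
    rw [sierpE_zero, Finset.mem_image] at h
    obtain ⟨i, -, h⟩ := h
    have hi : cornerPt (i + 1) ≠ cornerPt (i + 2) := by
      refine cornerPt_injective.ne ?_
      fin_cases i <;> decide
    rcases Sym2.eq_iff.1 h with ⟨rfl, rfl⟩ | ⟨rfl, rfl⟩
    · exact ⟨cornerPt_mem _ _, cornerPt_mem _ _, hi⟩
    · exact ⟨cornerPt_mem _ _, cornerPt_mem _ _, hi.symm⟩
  | succ n ih =>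
    obtain ⟨i, e, he, h⟩ := mem_sierpE_succ.1 h
    induction e using Sym2.ind with
    | _ a b =>
      obtain ⟨ha, hb, hab⟩ := ih he
      have hab' := (psi_injective i).ne hab
      rcases Sym2.eq_iff.1 h with ⟨rfl, rfl⟩ | ⟨rfl, rfl⟩
      · exact ⟨mem_sierpV_succ.2 ⟨i, a, ha, rfl⟩, mem_sierpV_succ.2 ⟨i, b, hb, rfl⟩, hab'⟩
      · exact ⟨mem_sierpV_succ.2 ⟨i, b, hb, rfl⟩, mem_sierpV_succ.2 ⟨i, a, ha, rfl⟩, hab'.symm⟩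

theorem map_psi_injective (i : Fin 3) : Function.Injective (Sym2.map (psi i)) :=
  Sym2.map.injective (psi_injective i)

theorem eq_of_map_psi_eq {n : ℕ} {e e' : Sym2 Pt} (he : e ∈ sierpE n) (he' : e' ∈ sierpE n)
    {i j : Fin 3} (h : Sym2.map (psi i) e = Sym2.map (psi j) e') : i = j ∧ e = e' := by
  have hij : i = j := by
    by_contra hij
    induction e using Sym2.ind with
    | _ a b =>
      induction e' using Sym2.ind with
      | _ c d =>
        obtain ⟨ha, hb, hab⟩ := mem_of_mem_sierpE he
        obtain ⟨hc, hd, -⟩ := mem_of_mem_sierpE he'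
        rcases Sym2.eq_iff.1 h with ⟨h1, h2⟩ | ⟨h1, h2⟩
        · exact hab ((psi_eq_psi ha hc hij h1).1.trans (psi_eq_psi hb hd hij h2).1.symm)
        · exact hab ((psi_eq_psi ha hd hij h1).1.trans (psi_eq_psi hb hc hij h2).1.symm)
  subst hij
  exact ⟨rfl, map_psi_injective i h⟩

/-- The union of the images of three edge sets in the three cells. -/
def glue (f : Fin 3 → Finset (Sym2 Pt)) : Finset (Sym2 Pt) :=
  Finset.univ.biUnion fun i => (f i).image (Sym2.map (psi i))

/-- The part of an edge set in the cell `i`. -/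
def cell (n : ℕ) (F : Finset (Sym2 Pt)) (i : Fin 3) : Finset (Sym2 Pt) :=
  (sierpE n).filter fun e => Sym2.map (psi i) e ∈ F

theorem mem_glue {f : Fin 3 → Finset (Sym2 Pt)} {e : Sym2 Pt} :
    e ∈ glue f ↔ ∃ i, ∃ e' ∈ f i, Sym2.map (psi i) e' = e := by
  simp [glue]

theorem map_mem_glue {n : ℕ} {f : Fin 3 → Finset (Sym2 Pt)} (hf : ∀ i, f i ⊆ sierpE n)
    {e : Sym2 Pt} (he : e ∈ sierpE n) {i : Fin 3} :
    Sym2.map (psi i) e ∈ glue f ↔ e ∈ f i := by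
  rw [mem_glue]
  constructor
  · rintro ⟨j, e', he', h⟩
    obtain ⟨rfl, rfl⟩ := eq_of_map_psi_eq (hf j he') he h
    exact he'
  · exact fun h => ⟨i, e, h, rfl⟩

theorem cell_subset (n : ℕ) (F : Finset (Sym2 Pt)) (i : Fin 3) : cell n F i ⊆ sierpE n :=
  Finset.filter_subset _ _

theorem glue_subset {n : ℕ} {f : Fin 3 → Finset (Sym2 Pt)} (hf : ∀ i, f i ⊆ sierpE n) :
    glue f ⊆ sierpE (n + 1) := by
  intro e he
  obtain ⟨i, e', he', h⟩ := mem_glue.1 he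
  exact mem_sierpE_succ.2 ⟨i, e', hf i he', h⟩

theorem cell_glue {n : ℕ} {f : Fin 3 → Finset (Sym2 Pt)} (hf : ∀ i, f i ⊆ sierpE n) :
    cell n (glue f) = f := by
  funext i
  ext e
  rw [cell, Finset.mem_filter]
  constructor
  · rintro ⟨he, h⟩
    exact (map_mem_glue hf he).1 h
  · exact fun h => ⟨hf i h, (map_mem_glue hf (hf i h)).2 h⟩

theorem glue_cell {n : ℕ} {F : Finset (Sym2 Pt)} (hF : F ⊆ sierpE (n + 1)) :
    glue (cell n F) = F := by
  ext e
  rw [mem_glue]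
  constructor
  · rintro ⟨i, e', he', rfl⟩
    exact (Finset.mem_filter.1 he').2
  · intro he
    obtain ⟨i, e', he', rfl⟩ := mem_sierpE_succ.1 (hF he)
    exact ⟨i, e', Finset.mem_filter.2 ⟨he', he⟩, rfl⟩

end Geometry

section Reachability

/-- Two points are connected by edges of `F`. -/
def Reach (F : Finset (Sym2 Pt)) (x y : Pt) : Prop := (graphOf F).Reachable x y

variable {F F' : Finset (Sym2 Pt)} {x y z : Pt}

theorem Reach.refl (F : Finset (Sym2 Pt)) (x : Pt) : Reach F x x := SimpleGraph.Reachable.refl x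

theorem Reach.symm (h : Reach F x y) : Reach F y x := SimpleGraph.Reachable.symm h

theorem Reach.trans (h : Reach F x y) (h' : Reach F y z) : Reach F x z :=
  SimpleGraph.Reachable.trans h h'

theorem Reach.of_mem (h : s(x, y) ∈ F) : Reach F x y := by
  by_cases hxy : x = y
  · exact hxy ▸ Reach.refl F x
  · exact SimpleGraph.Adj.reachable
      (by rw [graphOf, SimpleGraph.fromEdgeSet_adj]; exact ⟨h, hxy⟩)

theorem Reach.induct {P : Pt → Prop} (h : Reach F x y) (h0 : P x)
    (hs : ∀ a b, s(a, b) ∈ F → P a → P b) : P y := by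
  rw [Reach, SimpleGraph.reachable_iff_reflTransGen] at h
  induction h with
  | refl => exact h0
  | tail _ hab ih =>
    rw [graphOf, SimpleGraph.fromEdgeSet_adj] at hab
    exact hs _ _ hab.1 ih

theorem Reach.map {g : Pt → Pt} (h : Reach F x y) (hg : ∀ e ∈ F, Sym2.map g e ∈ F') :
    Reach F' (g x) (g y) :=
  h.induct (P := fun y => Reach F' (g x) (g y)) (Reach.refl _ _)
    fun a b hab ih => ih.trans (Reach.of_mem (hg s(a, b) hab))

theorem Reach.mono (h : Reach F x y) (hF : F ⊆ F') : Reach F' x y :=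
  h.induct (P := fun y => Reach F' x y) (Reach.refl _ _)
    fun _ _ hab ih => ih.trans (Reach.of_mem (hF hab))

theorem graphOf_erase (F : Finset (Sym2 Pt)) (e : Sym2 Pt) :
    graphOf (F.erase e) = (graphOf F).deleteEdges {e} := by
  ext a b
  simp only [graphOf, SimpleGraph.fromEdgeSet_adj, SimpleGraph.deleteEdges_adj, Finset.coe_erase,
    Set.mem_sdiff, Set.mem_singleton_iff, Finset.mem_coe]
  tauto

theorem acyclic_iff : (graphOf F).IsAcyclic ↔
    ∀ x y, x ≠ y → s(x, y) ∈ F → ¬ Reach (F.erase s(x, y)) x y := by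
  rw [SimpleGraph.isAcyclic_iff_forall_isBridge]
  simp only [Sym2.forall, SimpleGraph.mem_edgeSet, SimpleGraph.isBridge_iff, Reach, graphOf_erase]
  simp only [graphOf, SimpleGraph.fromEdgeSet_adj, Finset.mem_coe]
  exact ⟨fun h x y hxy hm => h x y ⟨hm, hxy⟩, fun h x y hm => h x y hm.2 hm.1⟩

theorem Reach.exists_first_edge (h : Reach F x y) (hxy : x ≠ y) :
    ∃ z, s(x, z) ∈ F ∧ x ≠ z ∧ Reach (F.erase s(x, z)) z y := by
  obtain ⟨p, hp⟩ := SimpleGraph.Reachable.exists_isPath h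
  cases p with
  | nil => exact absurd rfl hxy
  | @cons _ z _ hadj p =>
    rw [SimpleGraph.Walk.cons_isPath_iff] at hp
    have hadj' := hadj
    rw [graphOf, SimpleGraph.fromEdgeSet_adj] at hadj'
    refine ⟨z, hadj'.1, hadj'.2, ?_⟩
    rw [Reach, graphOf_erase]
    refine ⟨p.transfer _ fun e he => ?_⟩
    rw [SimpleGraph.edgeSet_deleteEdges]
    refine ⟨p.edges_subset_edgeSet he, fun h => hp.2 ?_⟩
    rw [Set.mem_singleton_iff] at h
    subst h
    exact p.fst_mem_support_of_mem_edges he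

open CornerPartition

/-- The partition of the corners induced by connectivity in `F`. -/
def cornerPartition (F : Finset (Sym2 Pt)) : CornerPartition :=
  ofRel fun j k => decide (Reach F (cornerPt j) (cornerPt k))

theorem rel_cornerPartition {j k : Fin 3} :
    rel (cornerPartition F) j k = true ↔ Reach F (cornerPt j) (cornerPt k) := by
  rw [cornerPartition, rel_ofRel]
  · simp
  · simp [Reach.refl]
  · simpa using fun i j => Reach.symm
  · simpa using fun i j k => Reach.trans

variable {n : ℕ} {f : Fin 3 → Finset (Sym2 Pt)}

theorem mem_glue_pair (hf : ∀ i, f i ⊆ sierpE n) {a b : Pt} (h : s(a, b) ∈ glue f) :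
    ∃ i, ∃ a' ∈ sierpV n, ∃ b' ∈ sierpV n, psi i a' = a ∧ psi i b' = b ∧ s(a', b') ∈ f i := by
  obtain ⟨i, e, he, h⟩ := mem_glue.1 h
  induction e using Sym2.ind with
  | _ c d =>
    obtain ⟨hc, hd, -⟩ := mem_of_mem_sierpE (hf i he)
    rcases Sym2.eq_iff.1 h with ⟨h1, h2⟩ | ⟨h1, h2⟩
    · exact ⟨i, c, hc, d, hd, h1, h2, he⟩
    · exact ⟨i, d, hd, c, hc, h2, h1, by rwa [Sym2.eq_swap]⟩

theorem Reach.glue (f : Fin 3 → Finset (Sym2 Pt)) {i : Fin 3} {a b : Pt} (h : Reach (f i) a b) :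
    Reach (glue f) (psi i a) (psi i b) :=
  h.map fun e he => mem_glue.2 ⟨i, e, he, rfl⟩

theorem Reach.glue_of_conn (f : Fin 3 → Finset (Sym2 Pt)) {i j k l : Fin 3}
    (h : conn (fun i => cornerPartition (f i)) i j k l = true) :
    Reach (_root_.glue f) (psi i (cornerPt j)) (psi k (cornerPt l)) := by
  have key : ∀ {i j l : Fin 3}, rel (cornerPartition (f i)) j l = true →
      Reach (_root_.glue f) (psi i (cornerPt j)) (psi i (cornerPt l)) :=
    fun h => (rel_cornerPartition.1 h).glue f
  have step : ∀ {i j k l : Fin 3} {x : Pt}, Reach (_root_.glue f) x (psi i (cornerPt k)) →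
      rel (cornerPartition (f k)) i l = true → Reach (_root_.glue f) x (psi k (cornerPt l)) := by
    intro i j k l x h h'
    rw [psi_cornerPt_comm] at h
    exact h.trans (key h')
  unfold conn at h
  by_cases hik : i = k
  · subst hik
    simp only [decide_true, cond_true, thru, Bool.or_eq_true, Bool.and_eq_true] at h
    rcases h with h | ⟨⟨h1, h2⟩, ⟨h3, h4⟩ | ⟨h3, h4⟩⟩
    · exact key h
    · exact step (j := 0) (step (j := 0) (step (j := 0) (key h3) h1) h2) h4
    · exact step (j := 0) (step (j := 0) (step (j := 0) (key h3) (rel_symm h2)) (rel_symm h1)) h4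
  · simp only [hik, decide_false, cond_false, Bool.or_eq_true, Bool.and_eq_true] at h
    rcases h with ⟨h1, h2⟩ | ⟨⟨h1, h2⟩, h3⟩
    · exact step (j := 0) (key h1) h2
    · exact step (j := 0) (step (j := 0) (key h1) h2) h3

theorem reach_glue_iff (hf : ∀ i, f i ⊆ sierpE n) {i k : Fin 3} {a b : Pt} (ha : a ∈ sierpV n)
    (hb : b ∈ sierpV n) : Reach (glue f) (psi i a) (psi k b) ↔
      (i = k ∧ Reach (f i) a b) ∨ ∃ j l, Reach (f i) a (cornerPt j) ∧
        conn (fun i => cornerPartition (f i)) i j k l = true ∧ Reach (f k) b (cornerPt l) := by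
  constructor
  · intro h
    refine h.induct (P := fun z => ∀ k, ∀ b ∈ sierpV n, z = psi k b →
      (i = k ∧ Reach (f i) a b) ∨ ∃ j l, Reach (f i) a (cornerPt j) ∧
        conn (fun i => cornerPartition (f i)) i j k l = true ∧ Reach (f k) b (cornerPt l))
      ?_ ?_ k b hb rfl
    · intro k b hb h
      by_cases hik : i = k
      · subst hik
        exact Or.inl ⟨rfl, psi_injective i h ▸ Reach.refl _ _⟩
      · obtain ⟨rfl, rfl⟩ := psi_eq_psi ha hb hik h
        exact Or.inr ⟨k, i, Reach.refl _ _, conn_swap (conn_of_rel (rel_refl _ _)), Reach.refl _ _⟩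
    · intro y z hyz ih k b hb hz
      obtain ⟨m, c, hc, d, hd, rfl, rfl, hcd⟩ := mem_glue_pair hf hyz
      have hcd := Reach.of_mem hcd
      have ihd : (i = m ∧ Reach (f i) a d) ∨ ∃ j l, Reach (f i) a (cornerPt j) ∧
          conn (fun i => cornerPartition (f i)) i j m l = true ∧ Reach (f m) d (cornerPt l) := by
        rcases ih m c hc rfl with ⟨rfl, h⟩ | ⟨j, l, h1, h2, h3⟩
        · exact Or.inl ⟨rfl, h.trans hcd⟩
        · exact Or.inr ⟨j, l, h1, h2, hcd.symm.trans h3⟩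
      by_cases hmk : m = k
      · subst hmk
        rwa [← psi_injective m hz]
      · obtain ⟨rfl, rfl⟩ := psi_eq_psi hd hb hmk hz
        rcases ihd with ⟨rfl, h⟩ | ⟨j, l, h1, h2, h3⟩
        · exact Or.inr ⟨k, i, h, conn_swap (conn_of_rel (rel_refl _ _)), Reach.refl _ _⟩
        · exact Or.inr ⟨j, m, h1, conn_swap (conn_step h2 (rel_cornerPartition.2 h3.symm)),
            Reach.refl _ _⟩
  · rintro (⟨rfl, h⟩ | ⟨j, l, h1, h2, h3⟩)
    · exact h.glue f
    · exact ((h1.glue f).trans (Reach.glue_of_conn f h2)).trans (h3.glue f).symm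

theorem reach_glue_corner_iff (hf : ∀ i, f i ⊆ sierpE n) {i j k l : Fin 3} :
    Reach (glue f) (psi i (cornerPt j)) (psi k (cornerPt l)) ↔
      conn (fun i => cornerPartition (f i)) i j k l = true := by
  refine ⟨fun h => ?_, Reach.glue_of_conn f⟩
  rcases (reach_glue_iff hf (cornerPt_mem n j) (cornerPt_mem n l)).1 h with
    ⟨rfl, h0⟩ | ⟨j', l', h1, h2, h3⟩
  · exact conn_of_rel (rel_cornerPartition.2 h0)
  · exact conn_symm (conn_step (conn_symm (conn_step h2 (rel_cornerPartition.2 h3.symm)))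
      (rel_cornerPartition.2 h1.symm))

theorem cornerPartition_glue (hf : ∀ i, f i ⊆ sierpE n) :
    cornerPartition (glue f) = glued fun i => cornerPartition (f i) := by
  have : ∀ j k, Reach (glue f) (cornerPt j) (cornerPt k) ↔
      conn (fun i => cornerPartition (f i)) j j k k = true := by
    intro j k
    rw [← reach_glue_corner_iff hf, psi_cornerPt_self, psi_cornerPt_self]
  simp only [cornerPartition, glued]
  congr 1
  funext j k
  rw [Bool.eq_iff_iff, decide_eq_true_eq]
  exact this j k

/-- Every vertex is connected to a corner. -/
def Spans (n : ℕ) (F : Finset (Sym2 Pt)) : Prop :=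
  ∀ x ∈ sierpV n, ∃ j, Reach F (cornerPt j) x

theorem spans_glue_iff (hf : ∀ i, f i ⊆ sierpE n) : Spans (n + 1) (glue f) ↔
    (∀ i, Spans n (f i)) ∧ ∀ i j, ∃ k, conn (fun i => cornerPartition (f i)) i j k k = true := by
  constructor
  · refine fun h => ⟨fun i a ha => ?_, fun i j => ?_⟩
    · obtain ⟨k, hk⟩ := h _ (mem_sierpV_succ.2 ⟨i, a, ha, rfl⟩)
      rw [← psi_cornerPt_self k] at hk
      rcases (reach_glue_iff hf ha (cornerPt_mem n k)).1 hk.symm with ⟨rfl, h⟩ | ⟨j, l, h, -⟩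
      exacts [⟨i, h.symm⟩, ⟨j, h.symm⟩]
    · obtain ⟨k, hk⟩ := h _ (mem_sierpV_succ.2 ⟨i, _, cornerPt_mem n j, rfl⟩)
      rw [← psi_cornerPt_self k] at hk
      exact ⟨k, (reach_glue_corner_iff hf).1 hk.symm⟩
  · rintro ⟨h1, h2⟩ x hx
    obtain ⟨i, a, ha, rfl⟩ := mem_sierpV_succ.1 hx
    obtain ⟨j, hj⟩ := h1 i a ha
    obtain ⟨k, hk⟩ := h2 i j
    refine ⟨k, ?_⟩
    rw [← psi_cornerPt_self k]
    exact (Reach.glue_of_conn f hk).symm.trans (hj.glue f)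

theorem Reach.glue_erase (hf : ∀ i, f i ⊆ sierpE n) {e : Sym2 Pt} (he : e ∈ sierpE n)
    {i j : Fin 3} (hij : i ≠ j) {a b : Pt} (h : Reach (f j) a b) :
    Reach ((_root_.glue f).erase (Sym2.map (psi i) e)) (psi j a) (psi j b) :=
  h.map fun e' he' => Finset.mem_erase.2
    ⟨fun h => hij (eq_of_map_psi_eq (hf j he') he h).1.symm, mem_glue.2 ⟨j, e', he', rfl⟩⟩

theorem Reach.erase_glue_erase {e : Sym2 Pt} {i : Fin 3} {a b : Pt}
    (h : Reach ((f i).erase e) a b) :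
    Reach ((_root_.glue f).erase (Sym2.map (psi i) e)) (psi i a) (psi i b) :=
  h.map fun _ he' => Finset.mem_erase.2
    ⟨fun h => (Finset.mem_erase.1 he').1 (map_psi_injective i h),
      mem_glue.2 ⟨i, _, (Finset.mem_erase.1 he').2, rfl⟩⟩

theorem glue_erase (hf : ∀ i, f i ⊆ sierpE n) {e : Sym2 Pt} {i : Fin 3} (he : e ∈ f i) :
    (glue f).erase (Sym2.map (psi i) e) = glue (Function.update f i ((f i).erase e)) := by
  ext e'
  rw [Finset.mem_erase, mem_glue, mem_glue]
  constructor
  · rintro ⟨hne, j, e', he', rfl⟩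
    refine ⟨j, e', ?_, rfl⟩
    by_cases hj : j = i
    · subst hj
      rw [Function.update_self]
      exact Finset.mem_erase.2 ⟨fun h => hne (by rw [h]), he'⟩
    · rwa [Function.update_of_ne hj]
  · rintro ⟨j, e', he', rfl⟩
    by_cases hj : j = i
    · subst hj
      rw [Function.update_self, Finset.mem_erase] at he'
      exact ⟨fun h => he'.1 (map_psi_injective j h), j, e', he'.2, rfl⟩
    · rw [Function.update_of_ne hj] at he'
      exact ⟨fun h => hj (eq_of_map_psi_eq (hf j he') (hf i he) h).1, j, e', he', rfl⟩

theorem acyclic_glue_iff (hf : ∀ i, f i ⊆ sierpE n) : (graphOf (glue f)).IsAcyclic ↔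
    (∀ i, (graphOf (f i)).IsAcyclic) ∧ (thru (fun i => cornerPartition (f i)) 0 &&
      rel (cornerPartition (f 0)) 1 2) = false := by
  constructor
  · rw [acyclic_iff]
    refine fun h => ⟨fun i => ?_, ?_⟩
    · rw [acyclic_iff]
      intro x y hxy hm hr
      exact h _ _ ((psi_injective i).ne hxy) (mem_glue.2 ⟨i, _, hm, rfl⟩) hr.erase_glue_erase
    · rw [Bool.eq_false_iff]
      intro hb
      simp only [thru, Bool.and_eq_true, rel_cornerPartition] at hb
      obtain ⟨⟨h1, h2⟩, h0⟩ := hb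
      obtain ⟨z, hz, hne, hr⟩ := h0.exists_first_edge (cornerPt_injective.ne (by decide))
      refine h _ _ ((psi_injective 0).ne hne) (mem_glue.2 ⟨0, _, hz, rfl⟩) ?_
      have e1 := h1.glue_erase hf (hf 0 hz) (i := 0) (by decide)
      have e2 := h2.glue_erase hf (hf 0 hz) (i := 0) (by decide)
      rw [psi_cornerPt_comm] at e1
      rw [psi_cornerPt_comm] at e2
      refine (e1.trans e2).trans ?_
      rw [psi_cornerPt_comm]
      exact hr.symm.erase_glue_erase
  · rintro ⟨hac, hb⟩
    rw [acyclic_iff]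
    intro x y hxy hm hr
    obtain ⟨i, a, ha, b, hb', rfl, rfl, hab⟩ := mem_glue_pair hf hm
    have hab' := Reach.of_mem hab
    have hna := acyclic_iff.1 (hac i) a b (fun h => hxy (by rw [h])) hab
    rw [← Sym2.map_mk, glue_erase hf hab] at hr
    have hf' : ∀ j, Function.update f i ((f i).erase s(a, b)) j ⊆ f j := by
      intro j
      by_cases hj : j = i
      · subst hj
        rw [Function.update_self]
        exact Finset.erase_subset _ _
      · rw [Function.update_of_ne hj]
    have hi : ∀ k : Fin 3, (k + 1 ≠ k) ∧ k + 2 ≠ k := by decide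
    rcases (reach_glue_iff (fun j => (hf' j).trans (hf j)) ha hb').1 hr with
      ⟨-, h⟩ | ⟨j, l, h1, h2, h3⟩
    · rw [Function.update_self] at h
      exact hna h
    · simp only [conn, decide_true, cond_true, thru, Bool.or_eq_true, Bool.and_eq_true,
        rel_cornerPartition, Function.update_of_ne (hi i).1, Function.update_of_ne (hi i).2] at h2
      have up : ∀ {x y}, Reach (Function.update f i ((f i).erase s(a, b)) i) x y →
          Reach (f i) x y := fun h => h.mono (hf' i)
      have hrot := thru_rotate (fun i => cornerPartition (f i)) i
      rw [hb, Bool.eq_false_iff] at hrot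
      simp only [thru, Bool.and_eq_true, rel_cornerPartition, ne_eq] at hrot
      rcases h2 with h2 | ⟨ht, ⟨h4, h5⟩ | ⟨h4, h5⟩⟩
      · have := (h1.trans h2).trans h3.symm
        rw [Function.update_self] at this
        exact hna this
      · exact hrot ⟨ht, (((up h4).symm.trans (up h1).symm).trans hab').trans
          ((up h3).trans (up h5).symm)⟩
      · exact hrot ⟨ht, (((up h5).trans (up h3).symm).trans hab'.symm).trans
          ((up h1).trans (up h4))⟩

/-- Spanning forests of `G_n` all of whose components contain a corner. -/
def IsForest (n : ℕ) (F : Finset (Sym2 Pt)) : Prop :=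
  (graphOf F).IsAcyclic ∧ Spans n F

theorem isForest_glue_iff (hf : ∀ i, f i ⊆ sierpE n) : IsForest (n + 1) (glue f) ↔
    (∀ i, IsForest n (f i)) ∧ good (fun i => cornerPartition (f i)) = true := by
  simp only [IsForest, acyclic_glue_iff hf, spans_glue_iff hf, good, Bool.and_eq_true,
    allFin_iff, Bool.not_eq_true', Bool.or_eq_true, forall_and]
  have : ∀ p : Fin 3 → Prop, (∃ k, p k) ↔ (p 0 ∨ p 1) ∨ p 2 := by
    intro p
    simp [Fin.exists_fin_succ, or_assoc]
  simp only [this]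
  tauto

end Reachability

section Triangle

open CornerPartition

/-- The edge of `G_0` opposite to the corner `i`. -/
def oppositeEdge (i : Fin 3) : Sym2 Pt := s(cornerPt (i + 1), cornerPt (i + 2))

/-- The edges of `G_0` selected by an indicator. -/
def triangleEdges (b : Fin 3 → Bool) : Finset (Sym2 Pt) :=
  (Finset.univ.filter fun i => b i = true).image oppositeEdge

theorem oppositeEdge_eq {i j : Fin 3} (h : i ≠ j) :
    oppositeEdge (-(i + j)) = s(cornerPt i, cornerPt j) := by
  have hs : ∀ i j : Fin 3, i ≠ j → (-(i + j) + 1 = i ∧ -(i + j) + 2 = j) ∨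
      (-(i + j) + 1 = j ∧ -(i + j) + 2 = i) := by decide
  rw [oppositeEdge]
  rcases hs i j h with ⟨h1, h2⟩ | ⟨h1, h2⟩
  · rw [h1, h2]
  · rw [h1, h2, Sym2.eq_swap]

theorem oppositeEdge_injective : Function.Injective oppositeEdge := by
  intro i j h
  have hs : ∀ i j : Fin 3, i + 1 = j + 1 ∨ (i + 1 = j + 2 ∧ i + 2 = j + 1) → i = j := by decide
  rcases Sym2.eq_iff.1 h with ⟨h1, -⟩ | ⟨h1, h2⟩
  · exact hs i j (Or.inl (cornerPt_injective h1))
  · exact hs i j (Or.inr ⟨cornerPt_injective h1, cornerPt_injective h2⟩)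

theorem oppositeEdge_mem {b : Fin 3 → Bool} {i : Fin 3} :
    oppositeEdge i ∈ triangleEdges b ↔ b i = true := by
  simp [triangleEdges, oppositeEdge_injective.eq_iff]

theorem mem_triangleEdges {b : Fin 3 → Bool} {e : Sym2 Pt} :
    e ∈ triangleEdges b ↔ ∃ i, b i = true ∧ oppositeEdge i = e := by
  simp [triangleEdges]

theorem triangleEdges_subset (b : Fin 3 → Bool) : triangleEdges b ⊆ sierpE 0 := by
  rw [sierpE_zero]
  exact Finset.image_subset_image (Finset.filter_subset _ _)

theorem triangleEdges_injective : Function.Injective triangleEdges := by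
  intro b c h
  funext i
  rw [Bool.eq_iff_iff, ← oppositeEdge_mem, h, oppositeEdge_mem]

theorem exists_triangleEdges {F : Finset (Sym2 Pt)} (hF : F ⊆ sierpE 0) :
    ∃ b, triangleEdges b = F := by
  refine ⟨fun i => decide (oppositeEdge i ∈ F), ?_⟩
  ext e
  rw [mem_triangleEdges]
  constructor
  · rintro ⟨i, hi, rfl⟩
    simpa using hi
  · intro he
    have := hF he
    rw [sierpE_zero, Finset.mem_image] at this
    obtain ⟨i, -, rfl⟩ := this
    exact ⟨i, decide_eq_true he, rfl⟩

theorem triangleRel_step {b : Fin 3 → Bool} {i j : Fin 3} (hi : b i = true) :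
    triangleRel b j (i + 1) = triangleRel b j (i + 2) := by
  have e1 : (-1 : Fin 3) = 2 := rfl
  have e2 : (-2 : Fin 3) = 1 := rfl
  rcases h0 : b 0 <;> rcases h1 : b 1 <;> rcases h2 : b 2 <;>
    fin_cases i <;> fin_cases j <;> simp_all [triangleRel]

theorem reach_triangleEdges {b : Fin 3 → Bool} {j k : Fin 3} :
    Reach (triangleEdges b) (cornerPt j) (cornerPt k) ↔ triangleRel b j k = true := by
  constructor
  · intro h
    have := h.induct (P := fun y => ∃ k, cornerPt k = y ∧ triangleRel b j k = true)
      ⟨j, rfl, by simp [triangleRel]⟩ ?_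
    · obtain ⟨k', hk, h⟩ := this
      rwa [← cornerPt_injective hk]
    · rintro _ z hz ⟨k, rfl, hk⟩
      obtain ⟨i, hi, he⟩ := mem_triangleEdges.1 hz
      rcases Sym2.eq_iff.1 he with ⟨h1, h2⟩ | ⟨h1, h2⟩
      · exact ⟨_, h2, by rwa [← triangleRel_step hi, cornerPt_injective h1]⟩
      · exact ⟨_, h1, by rwa [triangleRel_step hi, cornerPt_injective h2]⟩
  · intro h
    have key : ∀ {i j : Fin 3}, i ≠ j → b (-(i + j)) = true →
        Reach (triangleEdges b) (cornerPt i) (cornerPt j) := fun hij h =>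
      Reach.of_mem (oppositeEdge_eq hij ▸ oppositeEdge_mem.2 h)
    by_cases hjk : j = k
    · exact hjk ▸ Reach.refl _ _
    · simp only [triangleRel, hjk, decide_false, Bool.false_or, Bool.or_eq_true,
        Bool.and_eq_true] at h
      rcases h with h | ⟨h1, h2⟩
      · exact key hjk h
      · have hs : ∀ j k : Fin 3, j ≠ k → j ≠ -(j + k) ∧ -(j + k) ≠ k ∧
            -(j + -(j + k)) = k ∧ -(-(j + k) + k) = j := by decide
        obtain ⟨h3, h4, h5, h6⟩ := hs j k hjk
        exact (key h3 (by rwa [h5])).trans (key h4 (by rwa [h6]))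

theorem cornerPartition_triangleEdges (b : Fin 3 → Bool) :
    cornerPartition (triangleEdges b) = ofRel (triangleRel b) := by
  simp [cornerPartition, reach_triangleEdges]

theorem triangleEdges_erase {b : Fin 3 → Bool} {i : Fin 3} :
    (triangleEdges b).erase (oppositeEdge i) = triangleEdges (Function.update b i false) := by
  ext e
  rw [Finset.mem_erase, mem_triangleEdges, mem_triangleEdges]
  constructor
  · rintro ⟨hne, j, hj, rfl⟩
    exact ⟨j, by rwa [Function.update_of_ne fun h => hne (by rw [h])], rfl⟩
  · rintro ⟨j, hj, rfl⟩
    have hji : j ≠ i := by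
      rintro rfl
      simp at hj
    rw [Function.update_of_ne hji] at hj
    exact ⟨oppositeEdge_injective.ne hji, j, hj, rfl⟩

theorem isForest_triangleEdges {b : Fin 3 → Bool} :
    IsForest 0 (triangleEdges b) ↔ allFin b = false := by
  have hspan : Spans 0 (triangleEdges b) := by
    intro x hx
    obtain ⟨i, rfl⟩ := mem_sierpV_zero.1 hx
    exact ⟨i, Reach.refl _ _⟩
  have hr : ∀ i, Reach ((triangleEdges b).erase (oppositeEdge i)) (cornerPt (i + 1))
      (cornerPt (i + 2)) ↔ b (i + 1) = true ∧ b (i + 2) = true := by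
    intro i
    rw [triangleEdges_erase, reach_triangleEdges]
    have hs : ∀ i : Fin 3, i + 1 ≠ i + 2 ∧ -(i + 1 + (i + 2)) = i ∧ i + 1 ≠ i ∧ i + 2 ≠ i := by
      decide
    obtain ⟨h1, h2, h3, h4⟩ := hs i
    rw [triangleRel, h2, Function.update_self, Function.update_of_ne h3,
      Function.update_of_ne h4]
    simp [-add_right_inj, h1]
  have hall : allFin b = true ↔ ∃ i, b i = true ∧ b (i + 1) = true ∧ b (i + 2) = true := by
    rw [allFin_iff]
    refine ⟨fun h => ⟨0, h _, h _, h _⟩, fun ⟨i, h1, h2, h3⟩ j => ?_⟩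
    have hs : ∀ i j : Fin 3, j = i ∨ j = i + 1 ∨ j = i + 2 := by decide
    rcases hs i j with rfl | rfl | rfl
    exacts [h1, h2, h3]
  rw [← Bool.not_eq_true, hall, IsForest, and_iff_left hspan, acyclic_iff]
  constructor
  · rintro h ⟨i, h1, h2⟩
    refine h (cornerPt (i + 1)) (cornerPt (i + 2)) ?_ (oppositeEdge_mem.2 h1) ((hr i).2 h2)
    refine cornerPt_injective.ne ?_
    exact (by decide : ∀ i : Fin 3, i + 1 ≠ i + 2) i
  · rintro h x y - hm hxy
    obtain ⟨i, hi, he⟩ := mem_triangleEdges.1 hm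
    rw [← he] at hxy
    rcases Sym2.eq_iff.1 he with ⟨rfl, rfl⟩ | ⟨rfl, rfl⟩
    · exact h ⟨i, hi, (hr i).1 hxy⟩
    · exact h ⟨i, hi, (hr i).1 hxy.symm⟩

end Triangle

section Classes

open CornerPartition

/-- The spanning forests of `G_n` inducing a given partition of the corners. -/
def forests (n : ℕ) (r : CornerPartition) : Finset (Finset (Sym2 Pt)) :=
  (sierpE n).powerset.filter fun F => IsForest n F ∧ cornerPartition F = r

variable {n : ℕ} {r : CornerPartition} {F : Finset (Sym2 Pt)}

theorem mem_forests : F ∈ forests n r ↔ F ⊆ sierpE n ∧ IsForest n F ∧ cornerPartition F = r := by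
  rw [forests, Finset.mem_filter, Finset.mem_powerset]

theorem cornerPartition_eq_iff :
    cornerPartition F = r ↔ ∀ j k, Reach F (cornerPt j) (cornerPt k) ↔ rel r j k = true := by
  constructor
  · rintro rfl j k
    exact rel_cornerPartition.symm
  · exact fun h => eq_of_rel fun j k => Bool.eq_iff_iff.2 (rel_cornerPartition.trans (h j k))

theorem treeSet_eq (n : ℕ) : treeSet n = forests n one := by
  refine Finset.filter_congr fun F _ => ?_
  rw [IsForest, and_assoc, cornerPartition_eq_iff]
  refine and_congr_right fun _ => ⟨fun h => ⟨fun x hx => ⟨0, h _ (cornerPt_mem n 0) _ hx⟩,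
    fun j k => iff_of_true (h _ (cornerPt_mem n j) _ (cornerPt_mem n k)) rfl⟩, ?_⟩
  rintro ⟨h1, h2⟩ x hx y hy
  obtain ⟨j, hj⟩ := h1 x hx
  obtain ⟨k, hk⟩ := h1 y hy
  exact (hj.symm.trans ((h2 j k).2 rfl)).trans hk

theorem twoForestSet_eq (n : ℕ) (i : Fin 3) : twoForestSet n i = forests n (two i) := by
  refine Finset.filter_congr fun F _ => ?_
  rw [IsForest, and_assoc, cornerPartition_eq_iff]
  refine and_congr_right fun _ => ⟨fun ⟨h1, h2, h3⟩ => ⟨h3, fun j k => ?_⟩, fun ⟨h1, h2⟩ =>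
    ⟨fun j hj h => ?_, fun j k hj hk => (h2 j k).2 (by simp [rel, hj, hk]), h1⟩⟩
  · by_cases hj : j = i <;> by_cases hk : k = i
    · subst hj hk
      simpa [rel] using Reach.refl F _
    · subst hj
      simpa [rel, Ne.symm hk, Reach] using h1 k hk
    · subst hk
      simpa [rel, hj] using fun h => h1 j hj (Reach.symm h)
    · simpa [rel, hj, hk, Reach] using h2 j k hj hk
  · have := (h2 i j).1 h
    simp [rel, Ne.symm hj] at this

theorem threeForestSet_eq (n : ℕ) : threeForestSet n = forests n three := by
  refine Finset.filter_congr fun F _ => ?_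
  rw [IsForest, and_assoc, cornerPartition_eq_iff]
  refine and_congr_right fun _ => ⟨fun ⟨h1, h2⟩ => ⟨h2, fun j k => ?_⟩, fun ⟨h1, h2⟩ =>
    ⟨fun j k hjk h => ?_, h1⟩⟩
  · by_cases hjk : j = k
    · subst hjk
      simpa [rel] using Reach.refl F _
    · simpa [rel, hjk, Reach] using h1 j k hjk
  · have := (h2 j k).1 h
    simp [rel, hjk] at this

theorem forests_zero (r : CornerPartition) :
    forests 0 r = (triangleForests r).image triangleEdges := by
  ext F
  simp only [mem_forests, Finset.mem_image, triangleForests, Finset.mem_filter, Finset.mem_univ,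
    true_and, Bool.and_eq_true, Bool.not_eq_true', decide_eq_true_eq]
  constructor
  · rintro ⟨hF, h1, h2⟩
    obtain ⟨b, rfl⟩ := exists_triangleEdges hF
    exact ⟨b, ⟨isForest_triangleEdges.1 h1, cornerPartition_triangleEdges b ▸ h2⟩, rfl⟩
  · rintro ⟨b, ⟨h1, h2⟩, rfl⟩
    exact ⟨triangleEdges_subset b, isForest_triangleEdges.2 h1,
      (cornerPartition_triangleEdges b).trans h2⟩

theorem card_forests_zero (r : CornerPartition) : (forests 0 r).card = triangleCount r := by
  rw [forests_zero, Finset.card_image_of_injective _ triangleEdges_injective,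
    card_triangleForests]

theorem glue_mem_forests {f : Fin 3 → Finset (Sym2 Pt)} (hf : ∀ i, f i ⊆ sierpE n) :
    glue f ∈ forests (n + 1) r ↔ (∀ i, IsForest n (f i)) ∧
      good (fun i => cornerPartition (f i)) = true ∧
        glued (fun i => cornerPartition (f i)) = r := by
  rw [mem_forests, isForest_glue_iff hf, cornerPartition_glue hf]
  simp [glue_subset hf, and_assoc]

theorem card_image_glue {A : Fin 3 → Finset (Finset (Sym2 Pt))}
    (hA : ∀ i, ∀ F ∈ A i, F ⊆ sierpE n) :
    ((Fintype.piFinset A).image glue).card = ∏ i, (A i).card := by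
  rw [Finset.card_image_of_injOn, Fintype.card_piFinset]
  intro f hf g hg h
  rw [Finset.mem_coe, Fintype.mem_piFinset] at hf hg
  rw [← cell_glue fun i => hA i _ (hf i), ← cell_glue fun i => hA i _ (hg i), h]

end Classes

section Trace

open CornerPartition

variable {n : ℕ} {r : CornerPartition} {F : Finset (Sym2 Pt)} {f : Fin 3 → Finset (Sym2 Pt)}

theorem psiWord_cons {k : ℕ} (i : Fin 3) (w : Fin k → Fin 3) :
    psiWord (Fin.cons i w : Fin (k + 1) → Fin 3) = psi i ∘ psiWord w := by
  simp [psiWord, List.ofFn_succ]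

theorem map_psiWord_mem {k : ℕ} (w : Fin k → Fin 3) {e : Sym2 Pt} (he : e ∈ sierpE n) :
    Sym2.map (psiWord w) e ∈ sierpE (n + k) := by
  induction k with
  | zero => simpa [psiWord] using he
  | succ k ih =>
    rw [← Fin.cons_self_tail w, psiWord_cons, ← Sym2.map_map]
    exact mem_sierpE_succ.2 ⟨_, _, ih (Fin.tail w), rfl⟩

theorem trace_zero (hF : F ⊆ sierpE 1) : trace 0 F = traceCell F := by
  have h : ∀ w : Fin 0 → Fin 3, psiWord w = id := fun w => by simp [psiWord]
  have h' : ∀ w : Fin 0 → Fin 3, restrictE w 1 F = F := by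
    intro w
    rw [restrictE, h, Sym2.map_id]
    ext e
    exact Finset.mem_filter.trans ⟨fun h => h.2, fun h => ⟨hF h, h⟩⟩
  ext e
  simp [trace, h, h', Sym2.map_id]

theorem restrictE_cons_glue (hf : ∀ i, f i ⊆ sierpE (n + 1)) (i : Fin 3) (w : Fin n → Fin 3) :
    restrictE (Fin.cons i w : Fin (n + 1) → Fin 3) (n + 1 + 1) (glue f) =
      restrictE w (n + 1) (f i) := by
  have h1 : n + 1 + 1 - (n + 1) = 1 := by omega
  have h2 : n + 1 - n = 1 := by omega
  rw [restrictE, restrictE, h1, h2]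
  refine Finset.filter_congr fun e he => ?_
  rw [psiWord_cons, ← Sym2.map_map, map_mem_glue hf]
  rw [add_comm]
  exact map_psiWord_mem w he

theorem trace_succ_glue (hf : ∀ i, f i ⊆ sierpE (n + 1)) :
    trace (n + 1) (glue f) = glue fun i => trace n (f i) := by
  ext e
  simp only [trace, mem_glue, Finset.mem_biUnion, Finset.mem_univ, true_and, Finset.mem_image]
  constructor
  · rintro ⟨w, e', he', rfl⟩
    rw [← Fin.cons_self_tail w] at he' ⊢
    rw [restrictE_cons_glue hf] at he'
    exact ⟨w 0, _, ⟨Fin.tail w, e', he', rfl⟩, by rw [psiWord_cons, Sym2.map_map]⟩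
  · rintro ⟨i, _, ⟨w, e', he', rfl⟩, rfl⟩
    refine ⟨Fin.cons i w, e', ?_, by rw [psiWord_cons, Sym2.map_map]⟩
    rwa [restrictE_cons_glue hf]

theorem paths_mem_iff (hF : (graphOf F).IsAcyclic) {E : Finset (Sym2 Pt)} {x y : Pt}
    (hxy : Reach F x y) :
    (∀ p : (graphOf F).Walk x y, p.IsPath → ∀ e ∈ p.edges, e ∈ E) ↔
      Reach (F.filter fun e => e ∈ E) x y := by
  have hle : graphOf (F.filter fun e => e ∈ E) ≤ graphOf F :=
    SimpleGraph.fromEdgeSet_mono (by exact_mod_cast Finset.filter_subset _ _)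
  constructor
  · intro h
    obtain ⟨p, hp⟩ := SimpleGraph.Reachable.exists_isPath hxy
    refine ⟨p.transfer _ fun e he => ?_⟩
    have h1 := p.edges_subset_edgeSet he
    rw [graphOf, SimpleGraph.edgeSet_fromEdgeSet] at h1 ⊢
    exact ⟨Finset.mem_coe.2 (Finset.mem_filter.2 ⟨Finset.mem_coe.1 h1.1, h p hp e he⟩), h1.2⟩
  · intro h p hp e he
    obtain ⟨p', hp'⟩ := SimpleGraph.Reachable.exists_isPath h
    have : p = p'.mapLe hle :=
      congrArg Subtype.val ((hF.subsingleton_path x y).elim ⟨p, hp⟩ ⟨p'.mapLe hle, hp'.mapLe hle⟩)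
    rw [this, SimpleGraph.Walk.edges_mapLe_eq_edges] at he
    have h1 := p'.edges_subset_edgeSet he
    rw [graphOf, SimpleGraph.edgeSet_fromEdgeSet] at h1
    exact (Finset.mem_filter.1 (Finset.mem_coe.1 h1.1)).2

theorem glue_filter (hf : ∀ i, f i ⊆ sierpE n) (i j : Fin 3) :
    (glue f).filter (fun e => e ∈ psiCellE i n ∪ psiCellE j n) =
      glue fun k => bif decide (k = i) || decide (k = j) then f k else ∅ := by
  ext e
  simp only [Finset.mem_filter, mem_glue, Finset.mem_union, psiCellE, Finset.mem_image]
  constructor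
  · rintro ⟨⟨k, e', he', rfl⟩, ⟨e'', he'', h⟩ | ⟨e'', he'', h⟩⟩ <;>
      obtain ⟨rfl, rfl⟩ := eq_of_map_psi_eq he'' (hf k he') h <;>
      exact ⟨_, _, by simpa using he', rfl⟩
  · rintro ⟨k, e', he', rfl⟩
    by_cases hi : k = i
    · subst hi
      simp only [decide_true, Bool.true_or, cond_true] at he'
      exact ⟨⟨k, e', he', rfl⟩, Or.inl ⟨e', hf k he', rfl⟩⟩
    · by_cases hj : k = j
      · subst hj
        simp only [decide_true, Bool.or_true, cond_true] at he'
        exact ⟨⟨k, e', he', rfl⟩, Or.inr ⟨e', hf k he', rfl⟩⟩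
      · simp [hi, hj] at he'

theorem reach_empty {x y : Pt} (h : Reach ∅ x y) : x = y :=
  h.induct (P := fun y => x = y) rfl fun a b hab => by simp at hab

theorem glue_mem_treeClass (hf : ∀ i, f i ⊆ sierpE n) (i : Fin 3) :
    glue f ∈ treeClass (n + 1) i ↔ glue f ∈ forests (n + 1) one ∧
      central (fun i => cornerPartition (f i)) i = true := by
  rw [treeClass, Finset.mem_filter, treeSet_eq]
  refine and_congr_right fun h => ?_
  rw [mem_forests, cornerPartition_eq_iff] at h
  obtain ⟨-, ⟨hac, -⟩, hr⟩ := h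
  rw [central, allFin_iff]
  refine forall_congr' fun j => ?_
  by_cases hj : j = i
  · simp [hj]
  rw [paths_mem_iff hac ((hr i j).2 rfl), glue_filter hf, ← psi_cornerPt_self i,
    ← psi_cornerPt_self j, reach_glue_corner_iff]
  · have hs : ∀ i j : Fin 3, i ≠ j → -(i + j) ≠ i ∧ -(i + j) ≠ j := by decide
    obtain ⟨h1, h2⟩ := hs i j (Ne.symm hj)
    have h3 : rel (cornerPartition ∅) i j = false := by
      rw [Bool.eq_false_iff, ne_eq, rel_cornerPartition]
      exact fun h => hj (cornerPt_injective (reach_empty h)).symm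
    simp only [conn]
    generalize -(i + j) = c at h1 h2 ⊢
    simp [hj, Ne.symm hj, h1, h2, h3]
  · intro k
    cases decide (k = i) || decide (k = j)
    · exact Finset.empty_subset _
    · exact hf k

theorem filter_sierpE_zero (p : Sym2 Pt → Prop) [DecidablePred p] :
    (sierpE 0).filter p = triangleEdges fun i => decide (p (oppositeEdge i)) := by
  ext e
  rw [mem_triangleEdges, Finset.mem_filter, sierpE_zero, Finset.mem_image]
  constructor
  · rintro ⟨⟨i, -, rfl⟩, h⟩
    exact ⟨i, decide_eq_true h, rfl⟩
  · rintro ⟨i, h, rfl⟩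
    exact ⟨⟨i, Finset.mem_univ _, rfl⟩, of_decide_eq_true h⟩

theorem cornerPt_mem_oppositeEdge {i j : Fin 3} : cornerPt i ∈ oppositeEdge j ↔ j ≠ i := by
  rw [oppositeEdge, Sym2.mem_iff, cornerPt_injective.eq_iff, cornerPt_injective.eq_iff]
  exact (by decide : ∀ i j : Fin 3, (i = j + 1 ∨ i = j + 2) ↔ j ≠ i) i j

theorem star_eq (i : Fin 3) : (sierpE 0).filter (fun e => cornerPt i ∈ e) =
    triangleEdges fun j => !decide (j = i) := by
  rw [filter_sierpE_zero]
  simp [cornerPt_mem_oppositeEdge]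

theorem coStar_eq (i : Fin 3) : (sierpE 0).filter (fun e => cornerPt i ∉ e) =
    triangleEdges fun j => decide (j = i) := by
  rw [filter_sierpE_zero]
  simp [cornerPt_mem_oppositeEdge]

theorem traceCell_glue (hf : ∀ i, f i ⊆ sierpE 0) (h : IsForest 1 (glue f)) :
    traceCell (glue f) = triangleEdges (traceEdges fun i => cornerPartition (f i)) := by
  have hgood := ((isForest_glue_iff hf).1 h).2
  have hmem : ∀ r, glue f ∈ forests 1 r ↔ glued (fun i => cornerPartition (f i)) = r := by
    intro r
    rw [mem_forests, cornerPartition_glue hf]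
    simp [glue_subset hf, h]
  simp only [traceCell, star_eq, coStar_eq, glue_mem_treeClass hf, twoForestSet_eq, hmem]
  cases hq : glued fun i => cornerPartition (f i) with
  | one =>
    have hc := central_centre hgood hq
    have ht : traceEdges (fun i => cornerPartition (f i)) =
        fun j => !decide (j = centre fun i => cornerPartition (f i)) := by
      funext j
      simp only [traceEdges, hq]
    rw [ht]
    cases h0 : central (fun i => cornerPartition (f i)) 0
    · cases h1 : central (fun i => cornerPartition (f i)) 1
      · simp [centre, h0, h1] at hc
        simp [centre, h0, h1, hc]
      · simp [centre, h0, h1]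
    · simp [centre, h0]
  | two i =>
    have ht : traceEdges (fun i => cornerPartition (f i)) = fun j => decide (j = i) := by
      funext j
      simp only [traceEdges, hq]
    rw [ht]
    fin_cases i <;> simp
  | three =>
    have ht : traceEdges (fun i => cornerPartition (f i)) = fun j => false := by
      funext j
      simp only [traceEdges, hq]
    rw [ht]
    simp [triangleEdges]

theorem trace_mem_forests (h : F ∈ forests (n + 1) r) : trace n F ∈ forests n r := by
  have hF := (mem_forests.1 h).1
  have hsub := cell_subset n F
  have hF' := (mem_forests.1 h).2.1
  rw [← glue_cell hF] at h hF' ⊢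
  generalize cell n F = f at *
  induction n generalizing f r F with
  | zero =>
    obtain ⟨-, hg, hr⟩ := (glue_mem_forests hsub).1 h
    rw [trace_zero (glue_subset hsub), traceCell_glue hsub hF', mem_forests,
      cornerPartition_triangleEdges, isForest_triangleEdges, (triangle_traceEdges hg).2]
    exact ⟨triangleEdges_subset _, (triangle_traceEdges hg).1, hr⟩
  | succ n ih =>
    obtain ⟨hi, hg, hr⟩ := (glue_mem_forests hsub).1 h
    have key : ∀ i, trace n (f i) ∈ forests n (cornerPartition (f i)) := by
      intro i
      have := ih (F := f i) (r := cornerPartition (f i)) (hsub i) (cell n (f i))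
      rw [glue_cell (hsub i)] at this
      exact this (mem_forests.2 ⟨hsub i, hi i, rfl⟩) (cell_subset n _) (hi i)
    simp only [mem_forests, forall_and] at key
    rw [trace_succ_glue hsub, glue_mem_forests key.1]
    simp only [key.2.2]
    exact ⟨key.2.1, hg, hr⟩

theorem card_fibre_zero {b : Fin 3 → Bool} (hb : allFin b = false) :
    ((forests 1 (ofRel (triangleRel b))).filter fun F => trace 0 F = triangleEdges b).card =
      weight (ofRel (triangleRel b)) := by
  rw [← sum_traceEdges hb, Finset.card_eq_sum_card_fiberwise
    (f := fun F i => cornerPartition (cell 0 F i)) (t := Finset.univ) fun _ _ => Finset.mem_univ _]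
  refine Finset.sum_congr rfl fun q _ => ?_
  have hglue : ∀ f ∈ Fintype.piFinset fun i => forests 0 (q i), (∀ i, f i ⊆ sierpE 0) ∧
      (∀ i, IsForest 0 (f i)) ∧ (fun i => cornerPartition (f i)) = q := by
    intro f hf
    simp only [Fintype.mem_piFinset, mem_forests, forall_and] at hf
    exact ⟨hf.1, hf.2.1, funext hf.2.2⟩
  have htr : ∀ f, (∀ i, f i ⊆ sierpE 0) → IsForest 1 (glue f) →
      (trace 0 (glue f) = triangleEdges b ↔ traceEdges (fun i => cornerPartition (f i)) = b) := by
    intro f hf h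
    rw [trace_zero (glue_subset hf), traceCell_glue hf h, triangleEdges_injective.eq_iff]
  by_cases hq : good q = true ∧ traceEdges q = b
  · obtain ⟨hg, rfl⟩ := hq
    have hgl := (triangle_traceEdges hg).2
    rw [hg, (allFin_iff _).2 (by simp), Bool.true_and, cond_true]
    simp only [← card_forests_zero]
    rw [← card_image_glue (n := 0) fun i F hF => (mem_forests.1 hF).1]
    congr 1
    ext F
    simp only [Finset.mem_filter, Finset.mem_image]
    constructor
    · rintro ⟨⟨hF, -⟩, hqF⟩
      have hF1 := (mem_forests.1 hF).1
      rw [← glue_cell hF1, glue_mem_forests (cell_subset 0 F)] at hF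
      exact ⟨cell 0 F, Fintype.mem_piFinset.2 fun i => mem_forests.2
        ⟨cell_subset 0 F i, hF.1 i, congrFun hqF i⟩, glue_cell hF1⟩
    · rintro ⟨f, hf, rfl⟩
      obtain ⟨h1, h2, h3⟩ := hglue f hf
      have hF : glue f ∈ forests 1 (ofRel (triangleRel (traceEdges q))) := by
        rw [glue_mem_forests h1, h3]
        exact ⟨h2, hg, hgl.symm⟩
      refine ⟨⟨hF, (htr f h1 (mem_forests.1 hF).2.1).2 (by rw [h3])⟩, ?_⟩
      rw [cell_glue h1, h3]
  · have : (good q && allFin fun i => decide (traceEdges q i = b i)) = false := by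
      rw [Bool.eq_false_iff]
      intro h
      rw [Bool.and_eq_true, allFin_iff] at h
      exact hq ⟨h.1, funext fun i => of_decide_eq_true (h.2 i)⟩
    rw [this, cond_false, Finset.card_eq_zero, Finset.eq_empty_iff_forall_notMem]
    intro F hF
    simp only [Finset.mem_filter] at hF
    obtain ⟨⟨hF, ht⟩, hqF⟩ := hF
    have hF1 := (mem_forests.1 hF).1
    have hF2 := (mem_forests.1 hF).2.1
    rw [← glue_cell hF1] at ht hF hF2
    rw [htr _ (cell_subset 0 F) hF2, hqF] at ht
    rw [glue_mem_forests (cell_subset 0 F), hqF] at hF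
    exact hq ⟨hF.2.1, ht⟩

theorem card_fibre {g : Finset (Sym2 Pt)} (hg : g ∈ forests n r) :
    ((forests (n + 1) r).filter fun F => trace n F = g).card =
      weight r * 540 ^ ((3 ^ n - 1) / 2) := by
  induction n generalizing r g with
  | zero =>
    rw [forests_zero, Finset.mem_image] at hg
    obtain ⟨b, hb, rfl⟩ := hg
    simp only [triangleForests, Finset.mem_filter, Finset.mem_univ, true_and, Bool.and_eq_true,
      Bool.not_eq_true', decide_eq_true_eq] at hb
    obtain ⟨hb, rfl⟩ := hb
    simpa using card_fibre_zero hb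
  | succ n ih =>
    have hg1 := (mem_forests.1 hg).1
    have hsub := cell_subset n g
    rw [← glue_cell hg1] at hg ⊢
    generalize cell n g = f at *
    obtain ⟨hi, hgood, hr⟩ := (glue_mem_forests hsub).1 hg
    have hfib := fun i => ih (r := cornerPartition (f i)) (g := f i)
      (mem_forests.2 ⟨hsub i, hi i, rfl⟩)
    have heq : ((forests (n + 1 + 1) r).filter fun F => trace (n + 1) F = glue f) =
        (Fintype.piFinset fun i => (forests (n + 1) (cornerPartition (f i))).filter
          fun F => trace n F = f i).image glue := by
      ext F
      simp only [Finset.mem_filter, Finset.mem_image, Fintype.mem_piFinset]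
      constructor
      · rintro ⟨hF, ht⟩
        have hF1 := (mem_forests.1 hF).1
        have hc := cell_subset (n + 1) F
        rw [← glue_cell hF1] at hF ht
        rw [trace_succ_glue hc] at ht
        rw [glue_mem_forests hc] at hF
        have hm := fun i => trace_mem_forests (mem_forests.2 ⟨hc i, hF.1 i, rfl⟩)
        have ht' : (fun i => trace n (cell (n + 1) F i)) = f := by
          rw [← cell_glue hsub, ← ht, cell_glue fun i => (mem_forests.1 (hm i)).1]
        refine ⟨cell (n + 1) F, fun i => ⟨mem_forests.2 ⟨hc i, hF.1 i, ?_⟩, congrFun ht' i⟩,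
          glue_cell hF1⟩
        rw [← (mem_forests.1 (hm i)).2.2, ← ht']
      · rintro ⟨f', hf', rfl⟩
        simp only [mem_forests, forall_and] at hf'
        obtain ⟨⟨h1, h2, h3⟩, h4⟩ := hf'
        rw [glue_mem_forests h1, trace_succ_glue h1]
        simp only [h3, h4]
        exact ⟨⟨h2, hgood, hr⟩, trivial⟩
    have hpow : (3 ^ (n + 1) - 1) / 2 = 3 * ((3 ^ n - 1) / 2) + 1 := by
      have h1 : 3 ^ n % 2 = 1 := by simp [Nat.pow_mod]
      rw [pow_succ]
      omega
    rw [heq, card_image_glue (n := n + 1) fun i F hF =>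
      (mem_forests.1 (Finset.mem_filter.1 hF).1).1]
    simp only [hfib]
    rw [Finset.prod_mul_distrib, weight_glued hgood, hr, Finset.prod_const, Finset.card_univ,
      Fintype.card_fin, hpow]
    ring

theorem card_forests_succ (n : ℕ) (r : CornerPartition) :
    (forests (n + 1) r).card = (forests n r).card * (weight r * 540 ^ ((3 ^ n - 1) / 2)) := by
  rw [Finset.card_eq_sum_card_fiberwise (f := trace n) (t := forests n r)
    fun F hF => trace_mem_forests hF, Finset.sum_congr rfl fun g hg => card_fibre hg,
    Finset.sum_const, smul_eq_mul]

theorem card_fibre_div {g : Finset (Sym2 Pt)} (hg : g ∈ forests n r) :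
    (((forests (n + 1) r).filter fun F => trace n F = g).card : ℝ) / (forests (n + 1) r).card =
      1 / (forests n r).card := by
  have h1 : ((forests n r).card : ℝ) ≠ 0 := by
    exact_mod_cast (Finset.card_pos.2 ⟨g, hg⟩).ne'
  have h2 : (weight r : ℝ) ≠ 0 := by
    cases r <;> simp [weight]
  rw [card_fibre hg, card_forests_succ]
  push_cast
  field_simp

end Trace

/-- fibre cardinalities of the trace map and uniformity of the
pushforward of the uniform distributions. -/
theorem trace_preimage_counts (n : ℕ) :
    (∀ t ∈ treeSet n,
        ((treeSet (n + 1)).filter fun f => trace n f = t).card =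
          18 * 540 ^ ((3 ^ n - 1) / 2)) ∧
      (∀ i : Fin 3, ∀ g ∈ twoForestSet n i,
        ((twoForestSet (n + 1) i).filter fun f => trace n f = g).card =
          30 * 540 ^ ((3 ^ n - 1) / 2)) ∧
      (∀ g ∈ threeForestSet n,
        ((threeForestSet (n + 1)).filter fun f => trace n f = g).card =
          50 * 540 ^ ((3 ^ n - 1) / 2)) ∧
      (∀ t ∈ treeSet n,
        ((((treeSet (n + 1)).filter fun f => trace n f = t).card : ℝ) /
            ((treeSet (n + 1)).card : ℝ)) = 1 / ((treeSet n).card : ℝ)) ∧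
      (∀ i : Fin 3, ∀ g ∈ twoForestSet n i,
        ((((twoForestSet (n + 1) i).filter fun f => trace n f = g).card : ℝ) /
            ((twoForestSet (n + 1) i).card : ℝ)) = 1 / ((twoForestSet n i).card : ℝ)) ∧
      ∀ g ∈ threeForestSet n,
        ((((threeForestSet (n + 1)).filter fun f => trace n f = g).card : ℝ) /
            ((threeForestSet (n + 1)).card : ℝ)) = 1 / ((threeForestSet n).card : ℝ) := by
  simp only [treeSet_eq, twoForestSet_eq, threeForestSet_eq]
  exact ⟨fun t ht => card_fibre ht, fun i g hg => card_fibre hg, fun g hg => card_fibre hg,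
    fun t ht => card_fibre_div ht, fun i g hg => card_fibre_div hg,
    fun g hg => card_fibre_div hg⟩

end
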